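/- Given symmetric PSD matrices A₁,…,A_m ∈ ℝ^{d×d} and k ∈ {1,…,d} with d ≤ m, define B₁,…,B_{m+d−k} ∈ ℝ^{(m+d−k)×(m+d−k)} by Bᵢ = Aᵢ ⊕ I_{m−k} for i ≤ m, and Bᵢ = I_d ⊕ 0_{m−k} for m < i ≤ m+d−k. Then Σ_{S ⊆ [m], |S| = k} D̃((Aᵢ)_{i∈S}) = (1/((m−k)!(d−k)!)) · D(B₁,…,B_{m+d−k}), where D̃(A₁,…,A_k) = (1/(d−k)!) D(A₁,…,A_k, I, …, I) with I repeated d−k times. -/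

import Mathlib

open Matrix

/-- The mixed discriminant of a tuple of matrices: the coefficient of the monomial
`z₁⋯zₙ` (one `zᵢ` for each index `i`) in `det (∑ i, zᵢ • Aᵢ)`. -/
noncomputable def mixedDiscriminant {κ ι : Type} [Fintype κ] [Fintype ι] [DecidableEq ι]
    (A : κ → Matrix ι ι ℝ) : ℝ :=
  MvPolynomial.coeff (∑ i : κ, Finsupp.single i 1)
    (Matrix.det
      (∑ i : κ, (MvPolynomial.X i : MvPolynomial κ ℝ) •
        (A i).map (MvPolynomial.C : ℝ →+* MvPolynomial κ ℝ)))

section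
open MvPolynomial

variable {κ κ' : Type} {R : Type*} [CommRing R]

/-- A square-free coefficient of a determinant of a linear matrix pencil is a mixed discriminant. -/
theorem coeff_det_sum_X_smul_map {ι : Type} [Fintype κ] [Fintype κ'] [Fintype ι] [DecidableEq ι]
    (B : κ → Matrix ι ι ℝ) {f : κ' → κ} (hf : Function.Injective f) :
    coeff (∑ i : κ', Finsupp.single (f i) 1)
      (Matrix.det (∑ i : κ, (X i : MvPolynomial κ ℝ) • (B i).map (C : ℝ →+* MvPolynomial κ ℝ))) =
      mixedDiscriminant (B ∘ f) := by
  classical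
  have he : (∑ i : κ', Finsupp.single (f i) 1 : κ →₀ ℕ) =
      (∑ i : κ', Finsupp.single i 1 : κ' →₀ ℕ).mapDomain f := by
    simp [Finsupp.mapDomain_finsetSum, Finsupp.mapDomain_single]
  rw [he, ← coeff_killCompl hf, mixedDiscriminant, AlgHom.map_det]
  congr 2
  ext1 a b
  simp only [AlgHom.mapMatrix_apply, Matrix.map_apply, Matrix.sum_apply, Matrix.smul_apply,
    smul_eq_mul, map_sum, map_mul, killCompl_C, Function.comp_apply]
  symm
  refine Finset.sum_of_injOn f hf.injOn (by simp) ?_ ?_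
  · intro i _ hi
    have : i ∉ Set.range f := by simpa using hi
    rw [killCompl, aeval_X, dif_neg this, zero_mul]
  · intro i _
    rw [← rename_X f i, killCompl_rename_app]

theorem Finsupp.sum_single_one_apply [DecidableEq κ] (T : Finset κ) (i : κ) :
    (∑ j ∈ T, Finsupp.single j 1 : κ →₀ ℕ) i = if i ∈ T then 1 else 0 := by
  simp [Finsupp.finsetSum_apply, Finsupp.single_apply]

/-- Square-free coefficients of a product of two polynomials. -/
theorem MvPolynomial.coeff_sum_single_one_mul [Fintype κ] [DecidableEq κ]
    (p q : MvPolynomial κ R) :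
    coeff (∑ i : κ, Finsupp.single i 1) (p * q) =
      ∑ T : Finset κ, coeff (∑ i ∈ T, Finsupp.single i 1) p *
        coeff (∑ i ∈ Tᶜ, Finsupp.single i 1) q := by
  rw [coeff_mul]
  symm
  refine Finset.sum_bij (fun T _ => (∑ i ∈ T, Finsupp.single i 1, ∑ i ∈ Tᶜ, Finsupp.single i 1))
    ?_ ?_ ?_ ?_
  · intro T _
    simp [Finset.sum_add_sum_compl]
  · intro T _ T' _ h
    ext i
    have := DFunLike.congr_fun (congrArg Prod.fst h) i
    simp only [Finsupp.sum_single_one_apply] at this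
    split_ifs at this <;> simp_all
  · rintro ⟨a, b⟩ hab
    have hab' : ∀ i, a i + b i = 1 := fun i => by
      have := DFunLike.congr_fun (Finset.HasAntidiagonal.mem_antidiagonal.mp hab) i
      simpa [Finsupp.sum_single_one_apply] using this
    refine ⟨Finset.univ.filter (fun i => a i = 1), Finset.mem_univ _, ?_⟩
    ext i <;> simp only [Finsupp.sum_single_one_apply, Finset.mem_compl, Finset.mem_filter,
      Finset.mem_univ, true_and] <;> have := hab' i <;> split_ifs <;> omega
  · intros; rfl

/-- Square-free coefficients of a power of a sum of distinct variables. -/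
theorem MvPolynomial.coeff_sum_X_pow [DecidableEq κ] (U T : Finset κ) (n : ℕ) :
    coeff (∑ i ∈ T, Finsupp.single i 1) ((∑ i ∈ U, X i : MvPolynomial κ R) ^ n) =
      if T ⊆ U ∧ T.card = n then (n.factorial : R) else 0 := by
  induction n generalizing T with
  | zero =>
    rcases T.eq_empty_or_nonempty with rfl | ⟨i, hi⟩
    · simp
    · rw [pow_zero, coeff_one, if_neg, if_neg]
      · rintro ⟨-, h⟩
        simp [Finset.card_eq_zero.mp h] at hi
      · intro h
        have := DFunLike.congr_fun h i
        simp [Finsupp.sum_single_one_apply, hi] at this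
  | succ n ih =>
    have key : ∀ i ∈ U, coeff (∑ i ∈ T, Finsupp.single i 1)
        ((∑ i ∈ U, X i : MvPolynomial κ R) ^ n * X i) =
        if i ∈ T then (if T ⊆ U ∧ T.card = n + 1 then (n.factorial : R) else 0) else 0 := by
      intro i hi
      simp only [coeff_mul_X', Finsupp.mem_support_iff, Finsupp.sum_single_one_apply]
      by_cases hT : i ∈ T
      · have hsub : (∑ j ∈ T, Finsupp.single j 1 : κ →₀ ℕ) - Finsupp.single i 1 =
            ∑ j ∈ T.erase i, Finsupp.single j 1 := by
          rw [← Finset.sum_erase_add _ _ hT, add_tsub_cancel_right]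
        have hiff : (T.erase i ⊆ U ∧ (T.erase i).card = n) ↔ (T ⊆ U ∧ T.card = n + 1) := by
          have hc := Finset.card_erase_add_one hT
          rw [← Finset.subset_insert_iff, Finset.insert_eq_of_mem hi]
          exact and_congr_right fun _ => by omega
        simp only [hT, if_true, hsub, ih, hiff, ne_eq, one_ne_zero, not_false_eq_true]
      · simp [hT]
    rw [pow_succ, Finset.mul_sum, coeff_sum, Finset.sum_congr rfl key, ← Finset.sum_filter,
      Finset.sum_const, nsmul_eq_mul]
    by_cases h : T ⊆ U ∧ T.card = n + 1
    · rw [if_pos h, if_pos h, Finset.filter_mem_eq_inter, Finset.inter_eq_right.mpr h.1, h.2,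
        Nat.factorial_succ, Nat.cast_mul]
    · rw [if_neg h, if_neg h, mul_zero]

end

/-- the k-th elementary symmetric sum of the normalized mixed discriminants
D̃((Aᵢ)_{i∈S}) = (1/(d−k)!) D((Aᵢ)_{i∈S}, I, …, I) equals a single mixed discriminant
of the block-diagonal matrices Bᵢ = Aᵢ ⊕ I_{m−k} (for i ≤ m) and
Bᵢ = I_d ⊕ 0_{m−k} (for m < i ≤ m+d−k), up to the factor (m−k)!(d−k)!. -/
theorem sum_mixedDiscriminant_eq_single (m d k : ℕ) (A : Fin m → Matrix (Fin d) (Fin d) ℝ)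
    (hA : ∀ i, (A i).PosSemidef) (hk1 : 1 ≤ k) (hkd : k ≤ d) (hdm : d ≤ m) :
    ∑ S ∈ Finset.univ.powersetCard k,
        (1 / ((d - k).factorial : ℝ)) *
          mixedDiscriminant
            (Sum.elim (fun e : {x // x ∈ S} => A e.1) (fun _ : Fin (d - k) => 1) :
              ({x // x ∈ S} ⊕ Fin (d - k)) → Matrix (Fin d) (Fin d) ℝ) =
      (1 / (((m - k).factorial : ℝ) * ((d - k).factorial : ℝ))) *
        mixedDiscriminant
          (Sum.elim
              (fun i : Fin m =>
                Matrix.fromBlocks (A i) 0 0 (1 : Matrix (Fin (m - k)) (Fin (m - k)) ℝ))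
              (fun _ : Fin (d - k) =>
                Matrix.fromBlocks (1 : Matrix (Fin d) (Fin d) ℝ) 0 0 0) :
            (Fin m ⊕ Fin (d - k)) →
              Matrix (Fin d ⊕ Fin (m - k)) (Fin d ⊕ Fin (m - k)) ℝ) := by
  classical
  set B : Fin m ⊕ Fin (d - k) → Matrix (Fin d) (Fin d) ℝ := Sum.elim A (fun _ => 1) with hB
  set U : Finset (Fin m ⊕ Fin (d - k)) := Finset.univ.map Function.Embedding.inl with hU
  have hpencil : ∑ i : Fin m ⊕ Fin (d - k),
      (MvPolynomial.X i : MvPolynomial (Fin m ⊕ Fin (d - k)) ℝ) •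
        (Sum.elim
              (fun i : Fin m =>
                Matrix.fromBlocks (A i) 0 0 (1 : Matrix (Fin (m - k)) (Fin (m - k)) ℝ))
              (fun _ : Fin (d - k) =>
                Matrix.fromBlocks (1 : Matrix (Fin d) (Fin d) ℝ) 0 0 0) i).map
          (MvPolynomial.C : ℝ →+* MvPolynomial (Fin m ⊕ Fin (d - k)) ℝ) =
      Matrix.fromBlocks (∑ i, (MvPolynomial.X i : MvPolynomial (Fin m ⊕ Fin (d - k)) ℝ) •
        (B i).map (MvPolynomial.C : ℝ →+* MvPolynomial (Fin m ⊕ Fin (d - k)) ℝ)) 0 0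
        ((∑ i ∈ U, (MvPolynomial.X i : MvPolynomial (Fin m ⊕ Fin (d - k)) ℝ)) • 1) := by
    ext1 a b
    rcases a with a | a <;> rcases b with b | b <;>
      simp only [Matrix.sum_apply, hB, hU, Matrix.one_apply, Matrix.smul_apply, Matrix.map_apply,
        Fintype.sum_sum_type, Sum.elim_inl, Sum.elim_inr, Matrix.fromBlocks_apply₁₁,
        Matrix.fromBlocks_apply₁₂, Matrix.fromBlocks_apply₂₁, Matrix.fromBlocks_apply₂₂,
        Finset.sum_map, Function.Embedding.inl_apply] <;>
      first | simp; done | (by_cases h : a = b <;> simp [h, Matrix.sum_apply])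
  have hS : ∀ S ∈ (Finset.univ : Finset (Fin m)).powersetCard k,
      mixedDiscriminant
        (Sum.elim (fun e : {x // x ∈ S} => A e.1) (fun _ : Fin (d - k) => 1) :
              ({x // x ∈ S} ⊕ Fin (d - k)) → Matrix (Fin d) (Fin d) ℝ) =
      MvPolynomial.coeff (∑ i ∈ S.disjSum Finset.univ, Finsupp.single i 1)
        (Matrix.det (∑ i, (MvPolynomial.X i : MvPolynomial (Fin m ⊕ Fin (d - k)) ℝ) •
        (B i).map (MvPolynomial.C : ℝ →+* MvPolynomial (Fin m ⊕ Fin (d - k)) ℝ))) := by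
    intro S _
    have hf : Function.Injective
        (Sum.map (Subtype.val : {x // x ∈ S} → Fin m) (id : Fin (d - k) → Fin (d - k))) :=
      Subtype.val_injective.sumMap Function.injective_id
    have h := coeff_det_sum_X_smul_map B hf
    have hcomp : B ∘ Sum.map (Subtype.val : {x // x ∈ S} → Fin m) id =
        Sum.elim (fun e : {x // x ∈ S} => A e.1) (fun _ : Fin (d - k) => 1) := by
      ext1 (i | i) <;> rfl
    rw [hcomp] at h
    rw [← h]
    congr 1
    rw [Fintype.sum_sum_type, Finset.sum_disjSum, ← Finset.sum_coe_sort S]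
    rfl
  have hT : ∀ S : Finset (Fin m), S ∈ (Finset.univ : Finset (Fin m)).powersetCard k ↔
      (S.disjSum (Finset.univ : Finset (Fin (d - k))))ᶜ ⊆ U ∧
        (S.disjSum (Finset.univ : Finset (Fin (d - k))))ᶜ.card = m - k := by
    intro S
    have hc := Finset.card_le_univ S
    rw [Fintype.card_fin] at hc
    rw [Finset.mem_powersetCard, Finset.card_compl, Finset.card_disjSum, Fintype.card_sum]
    simp only [Fintype.card_fin, Finset.card_univ]
    constructor
    · rintro ⟨-, h⟩
      refine ⟨?_, by omega⟩
      rintro (i | i) <;> simp [hU]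
    · rintro ⟨-, h⟩
      exact ⟨Finset.subset_univ _, by omega⟩
  rw [Finset.sum_congr rfl fun S hS' => congrArg _ (hS S hS')]
  rw [mixedDiscriminant, hpencil, Matrix.det_fromBlocks_zero₂₁, Matrix.det_smul, Matrix.det_one,
    mul_one, Fintype.card_fin, MvPolynomial.coeff_sum_single_one_mul]
  simp only [MvPolynomial.coeff_sum_X_pow]
  rw [← Finset.mul_sum, ← Finset.sum_of_injOn (s := (Finset.univ : Finset (Fin m)).powersetCard k)
    (fun S => S.disjSum (Finset.univ : Finset (Fin (d - k))))
    (f := fun S => MvPolynomial.coeff (∑ i ∈ S.disjSum Finset.univ, Finsupp.single i 1)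
        (Matrix.det (∑ i, (MvPolynomial.X i : MvPolynomial (Fin m ⊕ Fin (d - k)) ℝ) •
        (B i).map (MvPolynomial.C : ℝ →+* MvPolynomial (Fin m ⊕ Fin (d - k)) ℝ))) *
        ((m - k).factorial : ℝ)) ?_ ?_ ?_ ?_, ← Finset.sum_mul]
  · have h1 : ((m - k).factorial : ℝ) ≠ 0 := by positivity
    field_simp
  · intro S _ S' _ h
    ext i
    have := Finset.ext_iff.mp h (Sum.inl i)
    simpa using this
  · intro S _
    simp
  · intro T _ hT'
    rw [if_neg, mul_zero]
    intro h
    apply hT'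
    have hTr : T.toLeft.disjSum (Finset.univ : Finset (Fin (d - k))) = T := by
      ext (i | i)
      · simp
      · have : Sum.inr i ∉ Tᶜ := fun hi => by simpa [hU] using h.1 hi
        simpa using this
    refine ⟨T.toLeft, ?_, hTr⟩
    rw [Finset.mem_coe, hT, hTr]
    exact h
  · intro S hS'
    rw [if_pos ((hT S).mp hS')]
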